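/- Let G be a finite group and N a normal subgroup of G. If N admits a minimal logarithmic signature and the quotient group G/N admits a minimal logarithmic signature, then G admits a minimal logarithmic signature. -/

import Mathlib

/-- The product map of a sequence of blocks: `(a₁, …, aₛ) ↦ a₁ ⋯ aₛ`. -/
def lsProd {G : Type*} [Group G] {s : ℕ} (A : Fin s → Finset G)
    (a : ∀ i, (A i : Finset G)) : G :=
  (List.ofFn fun i => ((a i : G))).prod

/-- The length of a sequence of blocks: the sum of their cardinalities. -/
def lsLength {G : Type*} [Group G] {s : ℕ} (A : Fin s → Finset G) : ℕ :=
  ∑ i, (A i).card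

/-- The minimal possible length `Σ aⱼ pⱼ` for a set of size `n = ∏ pⱼ^{aⱼ}`. -/
def lsTarget (n : ℕ) : ℕ :=
  n.factorization.sum fun p a => a * p

/-- `A` is a logarithmic signature for the group `G`: the product map is a bijection. -/
def IsLS {G : Type*} [Group G] {s : ℕ} (A : Fin s → Finset G) : Prop :=
  Function.Bijective (lsProd A)

/-- `B` is a logarithmic signature for the finite subset `S` of `G`:
the product map is injective with image exactly `S`. -/
def IsLSFor {G : Type*} [Group G] (S : Finset G) {t : ℕ} (B : Fin t → Finset G) : Prop :=
  Function.Injective (lsProd B) ∧ ∀ g : G, g ∈ S ↔ ∃ b, lsProd B b = g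

/-- The group `G` admits a minimal logarithmic signature. -/
def HasMLS (G : Type*) [Group G] : Prop :=
  ∃ (s : ℕ) (A : Fin s → Finset G), IsLS A ∧ lsLength A = lsTarget (Nat.card G)

/-- The finite subset `S` of `G` admits a minimal logarithmic signature. -/
def HasMLSFor {G : Type*} [Group G] (S : Finset G) : Prop :=
  ∃ (t : ℕ) (B : Fin t → Finset G), IsLSFor S B ∧ lsLength B = lsTarget S.card

theorem isLS_iff_existsUnique {G : Type*} [Group G] {s : ℕ} (A : Fin s → Finset G) :
    IsLS A ↔ ∀ g : G, ∃! a : Fin s → G, (∀ i, a i ∈ A i) ∧ (List.ofFn a).prod = g := by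
  rw [IsLS, Function.bijective_iff_existsUnique]
  refine forall_congr' fun g => ⟨?_, ?_⟩
  · rintro ⟨a, ha, hu⟩
    refine ⟨fun i => a i, ⟨fun i => (a i).2, ha⟩, ?_⟩
    rintro b ⟨hb, hbg⟩
    funext i
    exact congrArg Subtype.val (congrFun (hu (fun i => ⟨b i, hb i⟩) hbg) i)
  · rintro ⟨a, ⟨ha, hag⟩, hu⟩
    refine ⟨fun i => ⟨a i, ha i⟩, hag, fun b hb => ?_⟩
    funext i
    exact Subtype.ext (congrFun (hu (fun i => b i) ⟨fun i => (b i).2, hb⟩) i)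

theorem lsTarget_mul {m n : ℕ} (hm : m ≠ 0) (hn : n ≠ 0) :
    lsTarget (m * n) = lsTarget m + lsTarget n := by
  rw [lsTarget, Nat.factorization_mul hm hn]
  exact Finsupp.sum_add_index' (fun _ => zero_mul _) fun _ _ _ => add_mul _ _ _

theorem prod_ofFn_append {M : Type*} [Monoid M] {s t : ℕ} (a : Fin s → M) (b : Fin t → M) :
    (List.ofFn (Fin.append a b)).prod = (List.ofFn a).prod * (List.ofFn b).prod := by
  rw [List.ofFn_fin_append, List.prod_append]

/-- A logarithmic signature of `G ⧸ N`, lifted blockwise to `G` along a section of the quotient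
map, followed by a logarithmic signature of `N`, is a logarithmic signature of `G`. -/
theorem IsLS.append_quotient {G : Type*} [Group G] {N : Subgroup G} [N.Normal] {s t : ℕ}
    {A : Fin s → Finset (G ⧸ N)} {B : Fin t → Finset N} (hA : IsLS A) (hB : IsLS B) :
    IsLS (Fin.append (fun i => (A i).map ⟨Quotient.out, Quotient.out_injective⟩)
      (fun j => (B j).map ⟨Subtype.val, Subtype.val_injective⟩)) := by
  rw [isLS_iff_existsUnique] at hA hB ⊢
  have mk_prod (a : Fin s → G ⧸ N) :
      (((List.ofFn fun i => (a i).out).prod : G) : G ⧸ N) = (List.ofFn a).prod := by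
    rw [← QuotientGroup.mk'_apply, map_list_prod, List.map_ofFn]
    congr 2
    funext i
    exact QuotientGroup.out_eq' (a i)
  have val_prod (b : Fin t → N) :
      (List.ofFn fun j => (b j : G)).prod = ((List.ofFn b).prod : N) := by
    rw [← N.coe_subtype, map_list_prod, List.map_ofFn]
    rfl
  intro g
  obtain ⟨a, ⟨ha, hag⟩, hau⟩ := hA g
  have hn : (List.ofFn fun i => (a i).out).prod⁻¹ * g ∈ N := by
    rw [← QuotientGroup.eq, mk_prod, hag]
  obtain ⟨b, ⟨hb, hbn⟩, hbu⟩ := hB ⟨_, hn⟩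
  refine ⟨Fin.append (fun i => (a i).out) (fun j => b j), ⟨?_, ?_⟩, ?_⟩
  · intro i
    refine Fin.addCases (fun i => ?_) (fun j => ?_) i
    · rw [Fin.append_left, Fin.append_left]
      exact Finset.mem_map.2 ⟨_, ha i, rfl⟩
    · rw [Fin.append_right, Fin.append_right]
      exact Finset.mem_map.2 ⟨_, hb j, rfl⟩
  · rw [prod_ofFn_append, val_prod, hbn, mul_inv_cancel_left]
  · rintro c ⟨hc, hcg⟩
    have hl (i : Fin s) : ∃ q ∈ A i, q.out = c (Fin.castAdd t i) := by
      have h := hc (Fin.castAdd t i)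
      rw [Fin.append_left] at h
      exact Finset.mem_map.1 h
    have hr (j : Fin t) : ∃ n ∈ B j, (n : G) = c (Fin.natAdd s j) := by
      have h := hc (Fin.natAdd s j)
      rw [Fin.append_right] at h
      exact Finset.mem_map.1 h
    choose q hq hqc using hl
    choose n hn' hnc using hr
    have hcq : c = Fin.append (fun i => (q i).out) (fun j => (n j : G)) := by
      rw [← Fin.append_castAdd_natAdd (f := c)]
      simp only [hqc, hnc]
    rw [hcq, prod_ofFn_append, val_prod] at hcg
    obtain rfl : q = a := by
      refine hau q ⟨hq, ?_⟩
      rw [← mk_prod, ← hcg, QuotientGroup.mk_mul_of_mem _ (SetLike.coe_mem _)]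
    obtain rfl : n = b := by
      exact hbu n ⟨hn', Subtype.ext (eq_inv_mul_of_mul_eq hcg)⟩
    exact hcq

/-- if `N ⊴ G`, `N` admits an MLS and `G/N` admits an MLS, then `G`
admits an MLS. -/
theorem hasMLS_of_normal_and_quotient {G : Type*} [Group G] [Finite G]
    (N : Subgroup G) [N.Normal] (hN : HasMLS N) (hQ : HasMLS (G ⧸ N)) :
    HasMLS G := by
  obtain ⟨t, B, hB, hBl⟩ := hN
  obtain ⟨s, A, hA, hAl⟩ := hQ
  refine ⟨s + t, _, hA.append_quotient hB, ?_⟩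
  rw [N.card_eq_card_quotient_mul_card_subgroup,
    lsTarget_mul Nat.card_pos.ne' Nat.card_pos.ne', ← hAl, ← hBl]
  simp [lsLength, Fin.sum_univ_add]
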